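/- arXiv:2601.09849 — 8 statements merged into one kernel-verified Lean document; each statement's English description precedes it below -/
import Mathlib

section
/- Let v0 be a probability row vector in R^n (nonnegative entries summing to 1), let M be an n-by-n row-stochastic matrix, and let w be in (0,1]. Then the row vector w * v0 (I - (1-w)M)^{-1} is itself a probability vector: all its entries are nonnegative and they sum to 1. -/
open Matrix

/-- Minimum principle for `I - (1-w)M`. -/
lemma stmt3_minPrinciple {n : ℕ}
    (M : Matrix (Fin n) (Fin n) ℝ)
    (hM0 : ∀ i j, 0 ≤ M i j) (hM1 : ∀ i, ∑ j, M i j = 1)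
    (w : ℝ) (hw : w ∈ Set.Ioc (0 : ℝ) 1) (x : Fin n → ℝ)
    (hx : ∀ i, 0 ≤ ((1 - (1 - w) • M) *ᵥ x) i) : ∀ i, 0 ≤ x i := by
  intro i
  obtain ⟨k, -, hk⟩ := Finset.exists_min_image Finset.univ x ⟨i, Finset.mem_univ i⟩
  have h1 := hx k
  rw [sub_mulVec, one_mulVec, smul_mulVec, Pi.sub_apply, Pi.smul_apply, smul_eq_mul] at h1
  have h2 : x k ≤ (M *ᵥ x) k := by
    calc x k = ∑ j, M k j * x k := by rw [← Finset.sum_mul, hM1, one_mul]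
      _ ≤ ∑ j, M k j * x j := Finset.sum_le_sum fun j hj =>
          mul_le_mul_of_nonneg_left (hk j hj) (hM0 k j)
      _ = (M *ᵥ x) k := rfl
  have h3 := mul_le_mul_of_nonneg_left h2 (sub_nonneg.2 hw.2)
  have h4 : 0 ≤ w * x k := by linarith
  exact (nonneg_of_mul_nonneg_right h4 hw.1).trans (hk i (Finset.mem_univ i))

/-- If `v` is a probability row vector, `M` is row-stochastic and `w ∈ (0,1]`,
then the discounted occupation measure `w • (v ᵥ* (I - (1-w)M)⁻¹)` is a
probability vector. -/
theorem stmt3 {n : ℕ} (v : Fin n → ℝ)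
    (hv0 : ∀ i, 0 ≤ v i) (hv1 : ∑ i, v i = 1)
    (M : Matrix (Fin n) (Fin n) ℝ)
    (hM0 : ∀ i j, 0 ≤ M i j) (hM1 : ∀ i, ∑ j, M i j = 1)
    (w : ℝ) (hw : w ∈ Set.Ioc (0 : ℝ) 1) :
    (∀ i, 0 ≤ (w • (v ᵥ* (1 - (1 - w) • M)⁻¹)) i) ∧
    (∑ i, (w • (v ᵥ* (1 - (1 - w) • M)⁻¹)) i = 1) := by
  have hmin := stmt3_minPrinciple M hM0 hM1 w hw
  have hA1 : (1 - (1 - w) • M) *ᵥ (1 : Fin n → ℝ) = w • 1 := by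
    have : M *ᵥ (1 : Fin n → ℝ) = 1 := by
      ext i; simp [mulVec, dotProduct, hM1]
    rw [sub_mulVec, one_mulVec, smul_mulVec, this]
    ext i; simp
  generalize 1 - (1 - w) • M = A at *
  have hdet : IsUnit A.det := by
    rw [isUnit_iff_ne_zero]
    intro h0
    obtain ⟨x, hx, hAx⟩ := Matrix.exists_mulVec_eq_zero_iff.2 h0
    apply hx
    ext i
    have h1 := hmin x (by simp [hAx]) i
    have h2 := hmin (-x) (by simp [mulVec_neg, hAx]) i
    simp only [Pi.neg_apply, Pi.zero_apply] at *
    linarith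
  have hinv : ∀ i j, 0 ≤ A⁻¹ i j := by
    intro i j
    have := hmin (A⁻¹ *ᵥ Pi.single j 1) (by
      intro k
      rw [mulVec_mulVec, mul_nonsing_inv _ hdet, one_mulVec]
      by_cases h : k = j <;> simp [h]) i
    simpa using this
  have hw0 := hw.1
  constructor
  · intro i
    have h : (v ᵥ* A⁻¹) i = ∑ j, v j * A⁻¹ j i := rfl
    rw [Pi.smul_apply, smul_eq_mul, h]
    exact mul_nonneg hw0.le (Finset.sum_nonneg fun j _ => mul_nonneg (hv0 j) (hinv j i))
  · have h1 : w • (A⁻¹ *ᵥ (1 : Fin n → ℝ)) = 1 := by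
      rw [← mulVec_smul, ← hA1, mulVec_mulVec, nonsing_inv_mul _ hdet, one_mulVec]
    calc ∑ i, (w • (v ᵥ* A⁻¹)) i = (w • (v ᵥ* A⁻¹)) ⬝ᵥ 1 := by simp [dotProduct]
      _ = v ⬝ᵥ (w • (A⁻¹ *ᵥ 1)) := by
        rw [smul_dotProduct, dotProduct_smul, dotProduct_mulVec]
      _ = 1 := by rw [h1]; simpa [dotProduct] using hv1
end

section
/- For every memory-1 strategy p in [0,1]^5, every payoff vector g in R^4, and every w in (0,1], there exists a deterministic memory-1 strategy q* in {0,1}^5 such that pi_{w,g}(q*,p) >= pi_{w,g}(q,p) for all memory-1 strategies q in [0,1]^5. In other words, among memory-1 best responses to a memory-1 strategy, the maximum of the payoff over the cube [0,1]^5 is attained at a vertex, so checking the 2^5 = 32 deterministic memory-1 deviations suffices to verify optimality within memory-1 strategies. -/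
open Matrix

noncomputable section

/-- Initial state distribution over outcomes (LL, LR, RL, RR), from player 1's
perspective, for memory-1 strategies `q` (player 1) and `p` (player 2). -/
def v0 (q p : Fin 5 → ℝ) : Fin 4 → ℝ :=
  ![q 0 * p 0, q 0 * (1 - p 0), (1 - q 0) * p 0, (1 - q 0) * (1 - p 0)]

/-- Transition matrix on the states LL, LR, RL, RR for memory-1 strategies
`q` (player 1) and `p` (player 2). -/
def M (q p : Fin 5 → ℝ) : Matrix (Fin 4) (Fin 4) ℝ :=
  !![q 1 * p 1, q 1 * (1 - p 1), (1 - q 1) * p 1, (1 - q 1) * (1 - p 1);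
     q 2 * p 3, q 2 * (1 - p 3), (1 - q 2) * p 3, (1 - q 2) * (1 - p 3);
     q 3 * p 2, q 3 * (1 - p 2), (1 - q 3) * p 2, (1 - q 3) * (1 - p 2);
     q 4 * p 4, q 4 * (1 - p 4), (1 - q 4) * p 4, (1 - q 4) * (1 - p 4)]

/-- Player 1's expected per-round payoff `π_{w,g}(q,p)`
in the repeated game with stage game `g` and stopping probability `w`. -/
def payoff (w : ℝ) (g : Fin 4 → ℝ) (q p : Fin 5 → ℝ) : ℝ :=
  w * ((v0 q p ᵥ* (1 - (1 - w) • M q p)⁻¹) ⬝ᵥ g)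


/-- Co-player's cooperation probability in each state. -/
def coop (p : Fin 5 → ℝ) : Fin 4 → ℝ := ![p 1, p 3, p 2, p 4]

/-- Expected continuation value when playing L. -/
def valL (a : ℝ) (V : Fin 4 → ℝ) : ℝ := a * V 0 + (1 - a) * V 1

/-- Expected continuation value when playing R. -/
def valR (a : ℝ) (V : Fin 4 → ℝ) : ℝ := a * V 2 + (1 - a) * V 3

theorem M_mulVec (q p : Fin 5 → ℝ) (V : Fin 4 → ℝ) (s : Fin 4) :
    (M q p *ᵥ V) s = q s.succ * valL (coop p s) V + (1 - q s.succ) * valR (coop p s) V := by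
  fin_cases s <;>
    simp [M, Matrix.mulVec, dotProduct, Fin.sum_univ_four, coop, valL, valR] <;> ring

theorem v0_dot (q p : Fin 5 → ℝ) (V : Fin 4 → ℝ) :
    v0 q p ⬝ᵥ V = q 0 * valL (p 0) V + (1 - q 0) * valR (p 0) V := by
  simp [v0, dotProduct, Fin.sum_univ_four, valL, valR]; ring

theorem coop_mem {p : Fin 5 → ℝ} (hp : ∀ i, p i ∈ Set.Icc (0 : ℝ) 1) (s : Fin 4) :
    coop p s ∈ Set.Icc (0 : ℝ) 1 := by
  fin_cases s
  · exact hp 1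
  · exact hp 3
  · exact hp 2
  · exact hp 4

theorem mix_le {a x y c : ℝ} (ha : a ∈ Set.Icc (0 : ℝ) 1) (hx : x ≤ c) (hy : y ≤ c) :
    a * x + (1 - a) * y ≤ c := by
  obtain ⟨h0, h1⟩ := ha
  nlinarith [mul_le_mul_of_nonneg_left hx h0, mul_le_mul_of_nonneg_left hy (sub_nonneg.2 h1)]

theorem max_principle {p q : Fin 5 → ℝ} (hp : ∀ i, p i ∈ Set.Icc (0 : ℝ) 1)
    (hq : ∀ i, q i ∈ Set.Icc (0 : ℝ) 1) {w : ℝ} (hw : w ∈ Set.Ioc (0 : ℝ) 1)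
    (y : Fin 4 → ℝ) (hy : ∀ s, y s ≤ (1 - w) * (M q p *ᵥ y) s) : ∀ s, y s ≤ 0 := by
  obtain ⟨m, hm⟩ := Finite.exists_max y
  have hle : (M q p *ᵥ y) m ≤ y m := by
    rw [M_mulVec]
    exact mix_le (hq _) (mix_le (coop_mem hp m) (hm _) (hm _))
      (mix_le (coop_mem hp m) (hm _) (hm _))
  have h1 := hy m
  have h2 := mul_le_mul_of_nonneg_left hle (sub_nonneg.2 hw.2)
  have h3 : y m ≤ 0 := by
    by_contra h
    push Not at h
    nlinarith [mul_pos hw.1 h]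
  exact fun s => (hm s).trans h3

theorem isUnit_mat {p q : Fin 5 → ℝ} (hp : ∀ i, p i ∈ Set.Icc (0 : ℝ) 1)
    (hq : ∀ i, q i ∈ Set.Icc (0 : ℝ) 1) {w : ℝ} (hw : w ∈ Set.Ioc (0 : ℝ) 1) :
    IsUnit (1 - (1 - w) • M q p) := by
  rw [← Matrix.mulVec_injective_iff_isUnit]
  intro x y hxy
  have key : ∀ x y : Fin 4 → ℝ, (1 - (1 - w) • M q p) *ᵥ x = (1 - (1 - w) • M q p) *ᵥ y →
      ∀ s, x s ≤ y s := by
    intro x y h s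
    have := max_principle hp hq hw (x - y) (fun s => by
      have := congrFun h s
      simp only [Matrix.sub_mulVec, Matrix.one_mulVec, Matrix.smul_mulVec, Pi.sub_apply,
        Pi.smul_apply, smul_eq_mul] at this
      rw [Matrix.mulVec_sub]
      simp only [Pi.sub_apply]
      linarith) s
    simpa using this
  exact funext fun s => le_antisymm (key x y hxy s) (key y x hxy.symm s)

theorem payoff_eq {p q : Fin 5 → ℝ} (hp : ∀ i, p i ∈ Set.Icc (0 : ℝ) 1)
    (hq : ∀ i, q i ∈ Set.Icc (0 : ℝ) 1) {w : ℝ} (hw : w ∈ Set.Ioc (0 : ℝ) 1) (g : Fin 4 → ℝ) :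
    ∃ x : Fin 4 → ℝ, payoff w g q p = w * (v0 q p ⬝ᵥ x) ∧
      (∀ s, x s = g s + (1 - w) * (M q p *ᵥ x) s) := by
  refine ⟨(1 - (1 - w) • M q p)⁻¹ *ᵥ g, ?_, fun s => ?_⟩
  · rw [payoff, Matrix.dotProduct_mulVec]
  · have h : (1 - (1 - w) • M q p) *ᵥ ((1 - (1 - w) • M q p)⁻¹ *ᵥ g) = g := by
      rw [Matrix.mulVec_mulVec, Matrix.mul_nonsing_inv _
        ((Matrix.isUnit_iff_isUnit_det _).1 (isUnit_mat hp hq hw)), Matrix.one_mulVec]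
    have := congrFun h s
    rw [Matrix.sub_mulVec, Matrix.one_mulVec, Matrix.smul_mulVec] at this
    simp only [Pi.sub_apply, Pi.smul_apply, smul_eq_mul] at this
    linarith

theorem abs_mix {a : ℝ} (ha : a ∈ Set.Icc (0 : ℝ) 1) {x y x' y' d : ℝ}
    (hx : |x - x'| ≤ d) (hy : |y - y'| ≤ d) :
    |(a * x + (1 - a) * y) - (a * x' + (1 - a) * y')| ≤ d := by
  rw [abs_le] at *
  have h1 := mix_le ha hx.2 hy.2
  have h2 := mix_le (c := d) (x := -(x - x')) (y := -(y - y')) ha (by linarith) (by linarith)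
  constructor <;> nlinarith

theorem bellman {p : Fin 5 → ℝ} (hp : ∀ i, p i ∈ Set.Icc (0 : ℝ) 1)
    {w : ℝ} (hw : w ∈ Set.Ioc (0 : ℝ) 1) (g : Fin 4 → ℝ) :
    ∃ V : Fin 4 → ℝ, ∀ s,
      V s = g s + (1 - w) * max (valL (coop p s) V) (valR (coop p s) V) := by
  let T : (Fin 4 → ℝ) → (Fin 4 → ℝ) := fun V s =>
    g s + (1 - w) * max (valL (coop p s) V) (valR (coop p s) V)
  have hw1 : 0 ≤ 1 - w := sub_nonneg.2 hw.2
  have hT : ContractingWith ⟨1 - w, hw1⟩ T := by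
    refine ⟨?_, LipschitzWith.of_dist_le_mul fun x y => ?_⟩
    · refine NNReal.coe_lt_coe.1 ?_
      change 1 - w < 1
      linarith [hw.1]
    · change dist (T x) (T y) ≤ (1 - w) * dist x y
      rw [dist_pi_le_iff (mul_nonneg hw1 dist_nonneg)]
      intro s
      have hd : ∀ i, |x i - y i| ≤ dist x y := fun i => by
        rw [← Real.dist_eq]; exact dist_le_pi_dist x y i
      have e : T x s - T y s = (1 - w) * (max (valL (coop p s) x) (valR (coop p s) x)
          - max (valL (coop p s) y) (valR (coop p s) y)) := by
        simp only [T]; ring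
      rw [Real.dist_eq, e, abs_mul, abs_of_nonneg hw1]
      refine mul_le_mul_of_nonneg_left ?_ hw1
      refine (abs_max_sub_max_le_max _ _ _ _).trans (max_le ?_ ?_)
      · exact abs_mix (coop_mem hp s) (hd _) (hd _)
      · exact abs_mix (coop_mem hp s) (hd _) (hd _)
  refine ⟨ContractingWith.fixedPoint T hT, fun s => ?_⟩
  exact (congrFun hT.fixedPoint_isFixedPt.eq s).symm

/-- Among memory-1 strategies, the best response payoff against a fixed memory-1
strategy is attained at a vertex of the cube `[0,1]^5`, i.e. at a deterministic
memory-1 strategy. -/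
theorem stmt6 (p : Fin 5 → ℝ) (hp : ∀ i, p i ∈ Set.Icc (0 : ℝ) 1)
    (g : Fin 4 → ℝ) (w : ℝ) (hw : w ∈ Set.Ioc (0 : ℝ) 1) :
    ∃ qstar : Fin 5 → ℝ, (∀ i, qstar i = 0 ∨ qstar i = 1) ∧
      ∀ q : Fin 5 → ℝ, (∀ i, q i ∈ Set.Icc (0 : ℝ) 1) →
        payoff w g q p ≤ payoff w g qstar p := by
  obtain ⟨V, hV⟩ := bellman hp hw g
  have hw1 : 0 ≤ 1 - w := sub_nonneg.2 hw.2
  have greedy : ∀ a : ℝ, ∃ t : ℝ, (t = 0 ∨ t = 1) ∧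
      t * valL a V + (1 - t) * valR a V = max (valL a V) (valR a V) := by
    intro a
    rcases le_total (valL a V) (valR a V) with h | h
    · exact ⟨0, Or.inl rfl, by rw [max_eq_right h]; ring⟩
    · exact ⟨1, Or.inr rfl, by rw [max_eq_left h]; ring⟩
  choose t ht01 ht using greedy
  let qs : Fin 5 → ℝ := Fin.cons (t (p 0)) (fun s => t (coop p s))
  have hqs : ∀ i, qs i = 0 ∨ qs i = 1 := by
    intro i
    refine Fin.cases ?_ (fun s => ?_) i
    · exact ht01 _
    · exact ht01 _
  have hqsI : ∀ i, qs i ∈ Set.Icc (0 : ℝ) 1 := by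
    intro i
    rcases hqs i with h | h <;> rw [h] <;> simp
  refine ⟨qs, hqs, fun q hq => ?_⟩
  obtain ⟨x, hx, hx'⟩ := payoff_eq hp hq hw g
  obtain ⟨z, hz, hz'⟩ := payoff_eq hp hqsI hw g
  rw [hx, hz]
  refine mul_le_mul_of_nonneg_left ?_ hw.1.le
  have hxV : ∀ s, x s ≤ V s := fun s => by
    have := max_principle hp hq hw (x - V) (fun s => by
      have h1 : (M q p *ᵥ V) s ≤ max (valL (coop p s) V) (valR (coop p s) V) := by
        rw [M_mulVec]
        exact mix_le (hq _) (le_max_left _ _) (le_max_right _ _)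
      have h2 := mul_le_mul_of_nonneg_left h1 hw1
      rw [Matrix.mulVec_sub]
      simp only [Pi.sub_apply]
      have := hx' s
      have := hV s
      linarith) s
    simpa using this
  have hVz : ∀ s, V s ≤ z s := fun s => by
    have := max_principle hp hqsI hw (V - z) (fun s => by
      have h1 : (M qs p *ᵥ V) s = max (valL (coop p s) V) (valR (coop p s) V) := by
        rw [M_mulVec]
        exact ht (coop p s)
      rw [Matrix.mulVec_sub]
      simp only [Pi.sub_apply]
      rw [h1]
      have := hz' s
      have := hV s
      linarith) s
    simpa using this
  have mono : ∀ (r : Fin 5 → ℝ), (∀ i, r i ∈ Set.Icc (0 : ℝ) 1) → ∀ u v : Fin 4 → ℝ,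
      (∀ s, u s ≤ v s) → v0 r p ⬝ᵥ u ≤ v0 r p ⬝ᵥ v := by
    intro r hr u v h
    refine dotProduct_le_dotProduct_of_nonneg_left h ?_
    intro s
    have a1 := hr 0
    have a2 := hp 0
    fin_cases s
    · exact mul_nonneg a1.1 a2.1
    · exact mul_nonneg a1.1 (sub_nonneg.2 a2.2)
    · exact mul_nonneg (sub_nonneg.2 a1.2) a2.1
    · exact mul_nonneg (sub_nonneg.2 a1.2) (sub_nonneg.2 a2.2)
  calc v0 q p ⬝ᵥ x ≤ v0 q p ⬝ᵥ V := mono q hq _ _ hxV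
    _ ≤ max (valL (p 0) V) (valR (p 0) V) := by
        rw [v0_dot]
        exact mix_le (hq 0) (le_max_left _ _) (le_max_right _ _)
    _ = v0 qs p ⬝ᵥ V := by
        rw [v0_dot]
        exact (ht (p 0)).symm
    _ ≤ v0 qs p ⬝ᵥ z := mono qs hqsI _ _ hVz
end
end

section
/- Let g=(aLL,aLR,aRL,aRR) satisfy the Prisoner's Dilemma ordering aRL > aLL > aRR > aLR. Then for every w in (0,1], ALLD is a rival: pi_{w,g}(ALLD,q) >= pi_{w,g}(q,ALLD) for every memory-1 strategy q in [0,1]^5. -/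
open Matrix

noncomputable section

/-- The always-defect strategy. -/
def ALLD : Fin 5 → ℝ := ![0, 0, 0, 0, 0]

theorem aux_vecMul_inv (A : Matrix (Fin 4) (Fin 4) ℝ) (u v : Fin 4 → ℝ) (hA : A.det ≠ 0)
    (h : u ᵥ* A = v) : v ᵥ* A⁻¹ = u := by
  rw [← h, Matrix.vecMul_vecMul, Matrix.mul_nonsing_inv _ (isUnit_iff_ne_zero.mpr hA),
    Matrix.vecMul_one]

/-- Under the Prisoner's Dilemma ordering, ALLD is a rival: against any memory-1
co-player it earns at least as much as the co-player earns against it. -/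
theorem stmt8 (aLL aLR aRL aRR : ℝ)
    (h1 : aRL > aLL) (h2 : aLL > aRR) (h3 : aRR > aLR)
    (w : ℝ) (hw : w ∈ Set.Ioc (0 : ℝ) 1) :
    ∀ q : Fin 5 → ℝ, (∀ i, q i ∈ Set.Icc (0 : ℝ) 1) →
      payoff w ![aLL, aLR, aRL, aRR] ALLD q ≥ payoff w ![aLL, aLR, aRL, aRR] q ALLD := by
  intro q hq
  obtain ⟨hw0, hw1⟩ := hw
  have a0 : ALLD 0 = 0 := rfl
  have a1 : ALLD 1 = 0 := rfl
  have a2 : ALLD 2 = 0 := rfl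
  have a3 : ALLD 3 = 0 := rfl
  have a4 : ALLD 4 = 0 := rfl
  have hD : 0 < 1 - (1 - w) * (q 2 - q 4) := by
    nlinarith [(hq 2).1, (hq 2).2, (hq 4).1, (hq 4).2]
  have hE : 0 < w * (1 - (1 - w) * (q 2 - q 4)) := mul_pos hw0 hD
  obtain ⟨D, hDD⟩ : ∃ D, D = w * (1 - (1 - w) * (q 2 - q 4)) := ⟨_, rfl⟩
  rw [← hDD] at hE
  obtain ⟨x, hx⟩ : ∃ x, x = (q 0 * w + (1 - w) * q 4) / D := ⟨_, rfl⟩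
  obtain ⟨y, hy⟩ : ∃ y, y = ((1 - q 0) * (1 - (1 - w) * q 2) + (1 - w) * (1 - q 2) * q 0) / D :=
    ⟨_, rfl⟩
  have hx0 : 0 ≤ x := by
    rw [hx]
    have := mul_nonneg (hq 0).1 hw0.le
    have := mul_nonneg (sub_nonneg.2 hw1) (hq 4).1
    positivity
  have e1 : x * (1 - (1 - w) * q 2) - y * ((1 - w) * q 4) = q 0 := by
    rw [hx, hy]; field_simp; rw [hDD]; ring
  have e2 : y * (1 - (1 - w) * (1 - q 4)) - x * ((1 - w) * (1 - q 2)) = 1 - q 0 := by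
    rw [hx, hy]; field_simp; rw [hDD]; ring
  have k1 : v0 q ALLD ᵥ* (1 - (1 - w) • M q ALLD)⁻¹ = ![0, x, 0, y] := by
    apply aux_vecMul_inv
    · have : (1 - (1 - w) • M q ALLD).det = D := by
        rw [hDD]
        simp [M, a0, a1, a2, a3, a4, Matrix.det_succ_row_zero, Fin.sum_univ_succ, Fin.succAbove,
          Matrix.one_apply]
        try ring
      rw [this]; exact hE.ne'
    · ext i
      fin_cases i <;>
      simp [M, v0, a0, a1, a2, a3, a4, Matrix.vecMul, dotProduct, Fin.sum_univ_succ,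
          Matrix.one_apply] <;> linarith
  have k2 : v0 ALLD q ᵥ* (1 - (1 - w) • M ALLD q)⁻¹ = ![0, 0, x, y] := by
    apply aux_vecMul_inv
    · have : (1 - (1 - w) • M ALLD q).det = D := by
        rw [hDD]
        simp [M, a0, a1, a2, a3, a4, Matrix.det_succ_row_zero, Fin.sum_univ_succ, Fin.succAbove,
          Matrix.one_apply]
        try ring
      rw [this]; exact hE.ne'
    · ext i
      fin_cases i <;>
      simp [M, v0, a0, a1, a2, a3, a4, Matrix.vecMul, dotProduct, Fin.sum_univ_succ,
          Matrix.one_apply] <;> linarith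
  unfold payoff
  rw [k1, k2]
  apply mul_le_mul_of_nonneg_left _ hw0.le
  simp [dotProduct, Fin.sum_univ_succ]
  nlinarith
end
end

section
/- For g=(3,0,5,1) and every w in (0,1/2]: pi_{w,g}(GRIM,GRIM) = 3 and pi_{w,g}(q,GRIM) <= 3 for every memory-1 strategy q in [0,1]^5. Hence GRIM is a Nash equilibrium within memory-1 strategies and a partner (it sustains the mutual-cooperation payoff aLL = 3) for all stopping probabilities w <= 1/2. -/
open Matrix

noncomputable section

/-- The GRIM trigger strategy. -/
def GRIM : Fin 5 → ℝ := ![1, 1, 0, 0, 0]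

/-- Against GRIM, the payoff is computed by the solution `x` of the linear system
`x (I - (1-w) M) = v0`. -/
lemma payoff_grim (w : ℝ) (hw0 : 0 < w) (hw1 : w ≤ 1 / 2) (q : Fin 5 → ℝ)
    (hq : ∀ i, q i ∈ Set.Icc (0 : ℝ) 1) :
    ∃ a b c e : ℝ, payoff w ![3, 0, 5, 1] q GRIM = w * (3 * a + 5 * c + e) ∧
      a * (1 - (1 - w) * q 1) = q 0 ∧
      b = (1 - w) * (q 2 * b + q 3 * c + q 4 * e) ∧
      c = 1 - q 0 + (1 - w) * (1 - q 1) * a ∧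
      e = (1 - w) * ((1 - q 2) * b + (1 - q 3) * c + (1 - q 4) * e) := by
  have h1 := hq 1
  have h2 := hq 2
  have h4 := hq 4
  obtain ⟨h1a, h1b⟩ := h1
  obtain ⟨h2a, h2b⟩ := h2
  obtain ⟨h4a, h4b⟩ := h4
  have hA : (1 - (1 - w) • M q GRIM) =
      !![1 - (1 - w) * q 1, 0, -((1 - w) * (1 - q 1)), 0;
         0, 1 - (1 - w) * q 2, 0, -((1 - w) * (1 - q 2));
         0, -((1 - w) * q 3), 1, -((1 - w) * (1 - q 3));
         0, -((1 - w) * q 4), 0, 1 - (1 - w) * (1 - q 4)] := by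
    ext i j
    fin_cases i <;> fin_cases j <;> simp [M, GRIM]
  have hdet : (1 - (1 - w) • M q GRIM).det =
      (1 - (1 - w) * q 1) * (w * (1 - (1 - w) * q 2 + (1 - w) * q 4)) := by
    rw [hA]
    simp [Matrix.det_succ_row_zero, Fin.sum_univ_succ, Fin.succAbove]
    left
    ring
  have hp1 : 0 < 1 - (1 - w) * q 1 := by nlinarith
  have hp2 : 0 < 1 - (1 - w) * q 2 + (1 - w) * q 4 := by nlinarith
  have hu : IsUnit (1 - (1 - w) • M q GRIM).det := by
    rw [hdet, isUnit_iff_ne_zero]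
    positivity
  have hx : (v0 q GRIM ᵥ* (1 - (1 - w) • M q GRIM)⁻¹) ᵥ* (1 - (1 - w) • M q GRIM)
      = v0 q GRIM := by
    rw [Matrix.vecMul_vecMul, Matrix.nonsing_inv_mul _ hu, Matrix.vecMul_one]
  unfold payoff
  generalize (v0 q GRIM ᵥ* (1 - (1 - w) • M q GRIM)⁻¹) = x at hx ⊢
  rw [hA] at hx
  have e0 := congrFun hx 0
  have e1 := congrFun hx 1
  have e2 := congrFun hx 2
  have e3 := congrFun hx 3
  simp [v0, GRIM, Matrix.vecMul, dotProduct, Fin.sum_univ_four] at e0 e1 e2 e3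
  refine ⟨x 0, x 1, x 2, x 3, ?_, ?_, ?_, ?_, ?_⟩
  · simp [dotProduct, Fin.sum_univ_four]
    left
    ring
  · linarith
  · linarith
  · linarith
  · linarith

/-- For `g = (3,0,5,1)` and stopping probability `w ≤ 1/2`, GRIM is a Nash
equilibrium within memory-1 strategies and a partner: it earns the
mutual-cooperation payoff 3 against itself and no memory-1 strategy earns more
than 3 against it. -/
theorem stmt10 (w : ℝ) (hw : w ∈ Set.Ioc (0 : ℝ) (1 / 2)) :
    payoff w ![3, 0, 5, 1] GRIM GRIM = 3 ∧
    ∀ q : Fin 5 → ℝ, (∀ i, q i ∈ Set.Icc (0 : ℝ) 1) →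
      payoff w ![3, 0, 5, 1] q GRIM ≤ 3 := by
  obtain ⟨hw0, hw1⟩ := hw
  constructor
  · have hG : ∀ i, GRIM i ∈ Set.Icc (0 : ℝ) 1 := by
      intro i
      fin_cases i <;> simp [GRIM]
    obtain ⟨a, b, c, e, hpay, ha, hb, hc, he⟩ := payoff_grim w hw0 hw1 GRIM hG
    simp [GRIM] at ha hb hc he
    rw [hpay]
    subst hb
    have he0 : e = 0 := by
      have : w * e = 0 := by rw [hc] at he; linarith
      rcases mul_eq_zero.mp this with h | h
      · linarith
      · exact h
    rw [hc, he0]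
    linarith
  · intro q hq
    obtain ⟨a, b, c, e, hpay, ha, hb, hc, he⟩ := payoff_grim w hw0 hw1 q hq
    rw [hpay]
    obtain ⟨h0a, h0b⟩ := hq 0
    obtain ⟨h1a, h1b⟩ := hq 1
    obtain ⟨h2a, h2b⟩ := hq 2
    obtain ⟨h3a, h3b⟩ := hq 3
    obtain ⟨h4a, h4b⟩ := hq 4
    have hd : 0 ≤ 1 - w := by linarith
    have hp1 : 0 < 1 - (1 - w) * q 1 := by nlinarith
    have hp2 : 0 < 1 - (1 - w) * q 2 + (1 - w) * q 4 := by nlinarith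
    have ha0 : 0 ≤ a := nonneg_of_mul_nonneg_left (ha ▸ h0a) hp1
    have hc0 : 0 ≤ c := by
      have : 0 ≤ (1 - w) * (1 - q 1) * a :=
        mul_nonneg (mul_nonneg hd (by linarith)) ha0
      linarith
    have hS : w * (b + e) = (1 - w) * c := by linarith
    have hS0 : 0 ≤ b + e :=
      nonneg_of_mul_nonneg_right (hS ▸ mul_nonneg hd hc0) hw0
    have hb0 : 0 ≤ b := by
      have h : b * (1 - (1 - w) * q 2 + (1 - w) * q 4)
          = (1 - w) * (q 3 * c + q 4 * (b + e)) := by linarith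
      refine nonneg_of_mul_nonneg_left (h ▸ ?_) hp2
      exact mul_nonneg hd (add_nonneg (mul_nonneg h3a hc0) (mul_nonneg h4a hS0))
    have hsum : w * (a + b + c + e) = 1 := by linarith
    have hcS : w * c ≤ w * (b + e) := by nlinarith
    have hwb : 0 ≤ w * b := mul_nonneg hw0.le hb0
    linarith
end
end

section
/- For g=(3,0,5,1) and every w in (0,1]: pi_{w,g}(ALLD, Forgiver) = (6-w)/(2-w), which is strictly greater than 3 = pi_{w,g}(Forgiver, Forgiver). Hence the Forgiver strategy is not a Nash equilibrium within memory-1 strategies for any positive stopping probability w. -/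
open Matrix

noncomputable section

/-- The Forgiver ("Firm but Fair") strategy. -/
def Forgiver : Fin 5 → ℝ := ![1, 1, 0, 1, 1]

/-- Solving the linear system identifies the product with the inverse. -/
lemma vecMul_inv_eq (A : Matrix (Fin 4) (Fin 4) ℝ) (v x : Fin 4 → ℝ)
    (hA : A.det ≠ 0) (h : x ᵥ* A = v) : v ᵥ* A⁻¹ = x := by
  rw [← h, Matrix.vecMul_vecMul, Matrix.mul_nonsing_inv _ (isUnit_iff_ne_zero.mpr hA),
    Matrix.vecMul_one]

lemma matrix_AF (w : ℝ) : 1 - (1 - w) • M ALLD Forgiver =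
    !![1, 0, w - 1, 0; 0, 1, w - 1, 0; 0, 0, 1, w - 1; 0, 0, w - 1, 1] := by
  ext i j
  fin_cases i <;> fin_cases j <;> simp [M, ALLD, Forgiver]

lemma matrix_FF (w : ℝ) : 1 - (1 - w) • M Forgiver Forgiver =
    !![w, 0, 0, 0; 0, 1, w - 1, 0; 0, w - 1, 1, 0; w - 1, 0, 0, 1] := by
  ext i j
  fin_cases i <;> fin_cases j <;> simp [M, Forgiver]

lemma payoff_AF (w : ℝ) (h0 : 0 < w) (h1 : w ≤ 1) :
    payoff w ![3, 0, 5, 1] ALLD Forgiver = (6 - w) / (2 - w) := by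
  have h2 : 2 - w ≠ 0 := by linarith
  have hne : w ≠ 0 := h0.ne'
  unfold payoff
  rw [matrix_AF, vecMul_inv_eq _ _ ![0, 0, 1 / (w * (2 - w)), (1 - w) / (w * (2 - w))]]
  · simp [dotProduct, Fin.sum_univ_four]
    field_simp
    ring
  · have : (!![1, 0, w - 1, 0; 0, 1, w - 1, 0; 0, 0, 1, w - 1; 0, 0, w - 1, 1] :
        Matrix (Fin 4) (Fin 4) ℝ).det = w * (2 - w) := by
      simp [Matrix.det_succ_row_zero, Fin.sum_univ_succ, Fin.succAbove]
      ring
    rw [this]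
    exact mul_ne_zero hne h2
  · ext i
    fin_cases i <;> simp [v0, ALLD, Forgiver, vecMul, dotProduct, Fin.sum_univ_four] <;>
      field_simp <;> ring

lemma payoff_FF (w : ℝ) (h0 : 0 < w) (h1 : w ≤ 1) :
    payoff w ![3, 0, 5, 1] Forgiver Forgiver = 3 := by
  have h2 : 2 - w ≠ 0 := by linarith
  have hne : w ≠ 0 := h0.ne'
  unfold payoff
  rw [matrix_FF, vecMul_inv_eq _ _ ![1 / w, 0, 0, 0]]
  · simp [dotProduct, Fin.sum_univ_four]
    field_simp
  · have : (!![w, 0, 0, 0; 0, 1, w - 1, 0; 0, w - 1, 1, 0; w - 1, 0, 0, 1] :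
        Matrix (Fin 4) (Fin 4) ℝ).det = w * (w * (2 - w)) := by
      simp [Matrix.det_succ_row_zero, Fin.sum_univ_succ, Fin.succAbove]
      left
      ring
    rw [this]
    exact mul_ne_zero hne (mul_ne_zero hne h2)
  · ext i
    fin_cases i <;> simp [v0, Forgiver, vecMul, dotProduct, Fin.sum_univ_four, hne]

/-- For `g = (3,0,5,1)` and every `w ∈ (0,1]`: `π(ALLD, Forgiver) = (6-w)/(2-w)
> 3 = π(Forgiver, Forgiver)`, so Forgiver is not a Nash equilibrium within
memory-1 strategies for any positive stopping probability. -/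
theorem stmt11 (w : ℝ) (hw : w ∈ Set.Ioc (0 : ℝ) 1) :
    payoff w ![3, 0, 5, 1] ALLD Forgiver = (6 - w) / (2 - w) ∧
    payoff w ![3, 0, 5, 1] Forgiver Forgiver = 3 ∧
    payoff w ![3, 0, 5, 1] ALLD Forgiver > payoff w ![3, 0, 5, 1] Forgiver Forgiver ∧
    ¬ (∀ q : Fin 5 → ℝ, (∀ i, q i ∈ Set.Icc (0 : ℝ) 1) →
        payoff w ![3, 0, 5, 1] q Forgiver ≤ payoff w ![3, 0, 5, 1] Forgiver Forgiver) := by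
  obtain ⟨h0, h1⟩ := hw
  have hA := payoff_AF w h0 h1
  have hF := payoff_FF w h0 h1
  have hgt : payoff w ![3, 0, 5, 1] ALLD Forgiver >
      payoff w ![3, 0, 5, 1] Forgiver Forgiver := by
    rw [hA, hF, gt_iff_lt, lt_div_iff₀ (by linarith)]
    linarith
  refine ⟨hA, hF, hgt, fun h => ?_⟩
  refine absurd (h ALLD fun i => ?_) (not_le.mpr hgt)
  fin_cases i <;> simp [ALLD]
end
end

section
/- For g=(3,0,5,1), the Forgiver strategy is a Nash equilibrium in the limit of vanishing stopping probability: for every deterministic memory-1 strategy q in {0,1}^5, limsup_{w -> 0+} pi_{w,g}(q, Forgiver) <= 3, while lim_{w -> 0+} pi_{w,g}(Forgiver, Forgiver) = 3. -/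
open Matrix

noncomputable section

/-- Minimum principle for `1 - (1-w) M` with `M` row-stochastic. -/
lemma min_principle (A : Matrix (Fin 4) (Fin 4) ℝ) (hA : ∀ i j, 0 ≤ A i j)
    (hs : ∀ i, ∑ j, A i j = 1) (w : ℝ) (hw : 0 < w) (hw1 : w < 1) (y : Fin 4 → ℝ)
    (hy : ∀ i, 0 ≤ ((1 - (1 - w) • A) *ᵥ y) i) : ∀ i, 0 ≤ y i := by
  obtain ⟨i, hi⟩ := Finite.exists_min y
  have h1 : y i ≤ ∑ j, A i j * y j := by
    calc y i = ∑ j, A i j * y i := by rw [← Finset.sum_mul, hs, one_mul]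
      _ ≤ _ := Finset.sum_le_sum fun j _ => mul_le_mul_of_nonneg_left (hi j) (hA i j)
  have h2 := hy i
  rw [Matrix.sub_mulVec, Matrix.one_mulVec, Matrix.smul_mulVec] at h2
  simp only [Pi.sub_apply, Pi.smul_apply, smul_eq_mul] at h2
  have h3 : (A *ᵥ y) i = ∑ j, A i j * y j := rfl
  rw [h3] at h2
  have h4 : 0 ≤ w * y i := by nlinarith
  have h5 : 0 ≤ y i := nonneg_of_mul_nonneg_right h4 hw
  exact fun k => h5.trans (hi k)

/-- `1 - (1-w) M` is invertible. -/
lemma isUnit_det (A : Matrix (Fin 4) (Fin 4) ℝ) (hA : ∀ i j, 0 ≤ A i j)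
    (hs : ∀ i, ∑ j, A i j = 1) (w : ℝ) (hw : 0 < w) (hw1 : w < 1) :
    IsUnit (1 - (1 - w) • A).det := by
  rw [isUnit_iff_ne_zero]
  intro h0
  obtain ⟨y, hy0, hy⟩ := Matrix.exists_mulVec_eq_zero_iff.mpr h0
  apply hy0
  have h1 := min_principle A hA hs w hw hw1 y (by simp [hy])
  have h2 := min_principle A hA hs w hw hw1 (-y) (by simp [Matrix.mulVec_neg, hy])
  ext i
  have := h1 i
  have := h2 i
  simp only [Pi.neg_apply, Pi.zero_apply] at *
  linarith

lemma M_nonneg (q : Fin 5 → ℝ) (h0 : ∀ i, 0 ≤ q i) (h1 : ∀ i, q i ≤ 1) :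
    ∀ i j, 0 ≤ M q Forgiver i j := by
  have := h0 1; have := h0 2; have := h0 3; have := h0 4
  have := h1 1; have := h1 2; have := h1 3; have := h1 4
  intro i j
  fin_cases i <;> fin_cases j <;> simp [M, Forgiver] <;> assumption

lemma M_sum (q : Fin 5 → ℝ) : ∀ i, ∑ j, M q Forgiver i j = 1 := by
  intro i
  fin_cases i <;> simp [M, Forgiver, Fin.sum_univ_four]

/-- The bounds `0 ≤ π ≤ 3 + 2w`, from the potential `(0,-2,0,-2)`. -/
lemma payoff_bounds (q : Fin 5 → ℝ) (h0 : ∀ i, 0 ≤ q i) (h1 : ∀ i, q i ≤ 1)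
    (w : ℝ) (hw : 0 < w) (hw1 : w < 1) :
    0 ≤ payoff w ![3, 0, 5, 1] q Forgiver ∧
      payoff w ![3, 0, 5, 1] q Forgiver ≤ 3 + 2 * w := by
  have hA := M_nonneg q h0 h1
  have hs := M_sum q
  have hu := isUnit_det _ hA hs w hw hw1
  set N := 1 - (1 - w) • M q Forgiver with hN
  set x := N⁻¹ *ᵥ ![3, 0, 5, 1] with hx
  have hNx : N *ᵥ x = ![3, 0, 5, 1] := by
    rw [hx, Matrix.mulVec_mulVec, Matrix.mul_nonsing_inv _ hu, Matrix.one_mulVec]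
  have hpos : ∀ i, 0 ≤ x i := by
    apply min_principle _ hA hs w hw hw1
    rw [← hN, hNx]
    intro i
    fin_cases i <;> simp
  have hup : ∀ i, 0 ≤ ((![3 / w + 2, 3 / w, 3 / w + 2, 3 / w] : Fin 4 → ℝ) - x) i := by
    apply min_principle _ hA hs w hw hw1
    rw [← hN, Matrix.mulVec_sub, hNx, hN, Matrix.sub_mulVec, Matrix.one_mulVec,
      Matrix.smul_mulVec]
    have hc : w * (3 / w) = 3 := by field_simp
    generalize 3 / w = c at hc
    have := h0 1; have := h0 2; have := h0 3; have := h0 4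
    have := h1 1; have := h1 2; have := h1 3; have := h1 4
    intro i
    fin_cases i <;>
      simp [M, Forgiver, Matrix.vecHead, Matrix.vecTail] <;> nlinarith
  have hp : payoff w ![3, 0, 5, 1] q Forgiver = w * (q 0 * x 0 + (1 - q 0) * x 2) := by
    rw [payoff, ← hN, ← Matrix.dotProduct_mulVec, ← hx]
    simp [v0, Forgiver, dotProduct, Fin.sum_univ_four]
  have a0 := h0 0
  have a1 : 0 ≤ 1 - q 0 := sub_nonneg.mpr (h1 0)
  rw [hp]
  constructor
  · have := hpos 0; have := hpos 2; positivity
  · have u0 := hup 0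
    have u2 := hup 2
    simp at u0 u2
    calc w * (q 0 * x 0 + (1 - q 0) * x 2)
        ≤ w * (q 0 * (3 / w + 2) + (1 - q 0) * (3 / w + 2)) := by gcongr
      _ = 3 + 2 * w := by field_simp; ring

lemma payoff_self (w : ℝ) (hw : 0 < w) (hw1 : w < 1) :
    payoff w ![3, 0, 5, 1] Forgiver Forgiver = 3 := by
  have h0 : ∀ i, 0 ≤ Forgiver i := by intro i; fin_cases i <;> simp [Forgiver]
  have h1 : ∀ i, Forgiver i ≤ 1 := by intro i; fin_cases i <;> simp [Forgiver]
  have hu := isUnit_det _ (M_nonneg _ h0 h1) (M_sum _) w hw hw1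
  have hv : v0 Forgiver Forgiver ᵥ* (1 - (1 - w) • M Forgiver Forgiver)
      = w • v0 Forgiver Forgiver := by
    rw [Matrix.vecMul_sub, Matrix.vecMul_one, Matrix.vecMul_smul]
    ext i
    fin_cases i <;> simp [v0, M, Forgiver, Matrix.vecMul, dotProduct, Fin.sum_univ_four]
  have h2 : w • (v0 Forgiver Forgiver ᵥ* (1 - (1 - w) • M Forgiver Forgiver)⁻¹)
      = v0 Forgiver Forgiver := by
    rw [← Matrix.smul_vecMul, ← hv, Matrix.vecMul_vecMul, Matrix.mul_nonsing_inv _ hu,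
      Matrix.vecMul_one]
  rw [payoff, ← smul_eq_mul, ← smul_dotProduct, h2]
  simp [v0, Forgiver, dotProduct, Fin.sum_univ_four]

/-- For `g = (3,0,5,1)`, Forgiver is a Nash equilibrium in the limit of
vanishing stopping probability: for every deterministic memory-1 deviation `q`,
`limsup_{w → 0+} π_w(q, Forgiver) ≤ 3`, while
`lim_{w → 0+} π_w(Forgiver, Forgiver) = 3`. -/
theorem stmt12 :
    (∀ q : Fin 5 → ℝ, (∀ i, q i = 0 ∨ q i = 1) →
      Filter.limsup (fun w => payoff w ![3, 0, 5, 1] q Forgiver)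
        (nhdsWithin 0 (Set.Ioi 0)) ≤ 3) ∧
    Filter.Tendsto (fun w => payoff w ![3, 0, 5, 1] Forgiver Forgiver)
      (nhdsWithin 0 (Set.Ioi 0)) (nhds 3) := by
  have hev : ∀ᶠ w : ℝ in nhdsWithin 0 (Set.Ioi 0), 0 < w ∧ w < 1 :=
    Ioo_mem_nhdsGT one_pos
  constructor
  · intro q hq
    have h0 : ∀ i, 0 ≤ q i := fun i => by rcases hq i with h | h <;> simp [h]
    have h1 : ∀ i, q i ≤ 1 := fun i => by rcases hq i with h | h <;> simp [h]
    apply le_of_forall_pos_le_add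
    intro ε hε
    have hε' : ∀ᶠ w : ℝ in nhdsWithin 0 (Set.Ioi 0), 0 < w ∧ w < ε / 2 :=
      Ioo_mem_nhdsGT (by positivity)
    apply Filter.limsup_le_of_le
    · apply Filter.IsBoundedUnder.isCoboundedUnder_le
      refine ⟨0, ?_⟩
      rw [Filter.eventually_map]
      filter_upwards [hev] with w hw
      exact (payoff_bounds q h0 h1 w hw.1 hw.2).1
    · filter_upwards [hev, hε'] with w hw hw'
      have := (payoff_bounds q h0 h1 w hw.1 hw.2).2
      linarith [hw'.2]
  · apply tendsto_const_nhds.congr'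
    filter_upwards [hev] with w hw
    exact (payoff_self w hw.1 hw.2).symm
end
end

section
/- For g=(3,0,5,1) and every w in (0,1]: pi_{w,g}(ALLD, WSLS) = (6-w)/(2-w), which is strictly greater than 3 = pi_{w,g}(WSLS, WSLS). Hence Win-Stay Lose-Shift is not a Nash equilibrium within memory-1 strategies for the game g=(3,0,5,1) for any positive stopping probability w. -/
open Matrix

noncomputable section

/-- The Win-Stay Lose-Shift strategy. -/
def WSLS : Fin 5 → ℝ := ![1, 1, 0, 0, 1]

/-- Solving `y A = v` computes `v A⁻¹`. -/
lemma vecMul_inv_of_eq (A : Matrix (Fin 4) (Fin 4) ℝ) (y v : Fin 4 → ℝ)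
    (hA : A.det ≠ 0) (h : y ᵥ* A = v) : v ᵥ* A⁻¹ = y := by
  rw [← h, Matrix.vecMul_vecMul, Matrix.mul_nonsing_inv A (isUnit_iff_ne_zero.mpr hA),
    Matrix.vecMul_one]

lemma matALLD (w : ℝ) : (1 - (1 - w) • M ALLD WSLS) =
    !![1, 0, -(1 - w), 0; 0, 1, 0, -(1 - w); 0, 0, 1, -(1 - w); 0, 0, -(1 - w), 1] := by
  ext i j
  fin_cases i <;> fin_cases j <;> simp [M, ALLD, WSLS]

lemma matWSLS (w : ℝ) : (1 - (1 - w) • M WSLS WSLS) =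
    !![w, 0, 0, 0; 0, 1, 0, -(1 - w); 0, 0, 1, -(1 - w); -(1 - w), 0, 0, 1] := by
  ext i j
  fin_cases i <;> fin_cases j <;> simp [M, WSLS]

lemma payoff_ALLD (w : ℝ) (h0 : 0 < w) (h1 : w ≤ 1) :
    payoff w ![3, 0, 5, 1] ALLD WSLS = (6 - w) / (2 - w) := by
  have h2 : 2 - w ≠ 0 := by linarith
  have h3 : w ≠ 0 := h0.ne'
  have key : v0 ALLD WSLS ᵥ* (1 - (1 - w) • M ALLD WSLS)⁻¹ =
      ![0, 0, 1 / (w * (2 - w)), (1 - w) / (w * (2 - w))] := by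
    apply vecMul_inv_of_eq
    · rw [matALLD]
      have : w * (2 - w) ≠ 0 := mul_ne_zero h3 h2
      convert this using 1
      simp [Matrix.det_succ_row_zero, Fin.sum_univ_succ, Fin.succAbove]
      ring
    · rw [matALLD]
      ext i
      fin_cases i <;>
        simp [Matrix.vecMul, dotProduct, Fin.sum_univ_succ, v0, ALLD, WSLS] <;>
        field_simp <;> ring
  rw [payoff, key]
  simp [dotProduct, Fin.sum_univ_succ]
  field_simp
  ring

lemma payoff_WSLS (w : ℝ) (h0 : 0 < w) :
    payoff w ![3, 0, 5, 1] WSLS WSLS = 3 := by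
  have h3 : w ≠ 0 := h0.ne'
  have key : v0 WSLS WSLS ᵥ* (1 - (1 - w) • M WSLS WSLS)⁻¹ = ![1 / w, 0, 0, 0] := by
    apply vecMul_inv_of_eq
    · rw [matWSLS]
      convert h3 using 1
      simp [Matrix.det_succ_row_zero, Fin.sum_univ_succ, Fin.succAbove]
    · rw [matWSLS]
      ext i
      fin_cases i <;>
        simp [Matrix.vecMul, dotProduct, Fin.sum_univ_succ, v0, WSLS, h3]
  rw [payoff, key]
  simp [dotProduct, Fin.sum_univ_succ]
  field_simp

/-- For `g = (3,0,5,1)` and every `w ∈ (0,1]`: `π(ALLD, WSLS) = (6-w)/(2-w)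
> 3 = π(WSLS, WSLS)`, so WSLS is not a Nash equilibrium within memory-1
strategies for any positive stopping probability. -/
theorem stmt13 (w : ℝ) (hw : w ∈ Set.Ioc (0 : ℝ) 1) :
    payoff w ![3, 0, 5, 1] ALLD WSLS = (6 - w) / (2 - w) ∧
    payoff w ![3, 0, 5, 1] WSLS WSLS = 3 ∧
    payoff w ![3, 0, 5, 1] ALLD WSLS > payoff w ![3, 0, 5, 1] WSLS WSLS ∧
    ¬ (∀ q : Fin 5 → ℝ, (∀ i, q i ∈ Set.Icc (0 : ℝ) 1) →
        payoff w ![3, 0, 5, 1] q WSLS ≤ payoff w ![3, 0, 5, 1] WSLS WSLS) := by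
  obtain ⟨h0, h1⟩ := hw
  have ha := payoff_ALLD w h0 h1
  have hb := payoff_WSLS w h0
  have hgt : payoff w ![3, 0, 5, 1] ALLD WSLS > payoff w ![3, 0, 5, 1] WSLS WSLS := by
    rw [ha, hb, gt_iff_lt, lt_div_iff₀ (by linarith)]
    linarith
  refine ⟨ha, hb, hgt, fun h => ?_⟩
  refine absurd (h ALLD ?_) (not_le.mpr hgt)
  intro i
  fin_cases i <;> simp [ALLD]
end
end

section
/- Let q and p be memory-1 strategies whose continuation part is Tit-for-Tat, i.e. (q1,q2,q3,q4)=(p1,p2,p3,p4)=(1,0,1,0), with arbitrary first-round cooperation probabilities q0, p0 in [0,1]. Then for every payoff vector g=(aLL,aLR,aRL,aRR), lim_{w -> 0+} pi_{w,g}(q,p) = q0*p0*aLL + (1-q0)*(1-p0)*aRR + (q0*(1-p0) + (1-q0)*p0)*(aLR+aRL)/2. In particular, for q0=0.4 and p0=0.6 the limiting per-round payoff is 0.24*aLL + 0.24*aRR + 0.52*(aRL+aLR)/2. -/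
open Matrix

noncomputable section

theorem tft_inv (q0 p0 w : ℝ) (hw : w ≠ 0) (hw2 : 2 - w ≠ 0) :
    (1 - (1 - w) • M ![q0, 1, 0, 1, 0] ![p0, 1, 0, 1, 0])⁻¹ =
      !![1 / w, 0, 0, 0;
         0, 1 / (w * (2 - w)), (1 - w) / (w * (2 - w)), 0;
         0, (1 - w) / (w * (2 - w)), 1 / (w * (2 - w)), 0;
         0, 0, 0, 1 / w] := by
  apply Matrix.inv_eq_right_inv
  ext i j
  fin_cases i <;> fin_cases j <;>
    simp [M, Matrix.mul_apply, Fin.sum_univ_four, Matrix.one_apply] <;>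
    field_simp <;> ring

theorem tft_payoff (q0 p0 aLL aLR aRL aRR w : ℝ) (hw : w ≠ 0) (hw2 : 2 - w ≠ 0) :
    payoff w ![aLL, aLR, aRL, aRR] ![q0, 1, 0, 1, 0] ![p0, 1, 0, 1, 0] =
      q0 * p0 * aLL + (1 - q0) * (1 - p0) * aRR +
      (q0 * (1 - p0) * (aLR + (1 - w) * aRL) + (1 - q0) * p0 * ((1 - w) * aLR + aRL))
        / (2 - w) := by
  rw [payoff, tft_inv q0 p0 w hw hw2]
  simp [v0, Matrix.vecMul, dotProduct, Fin.sum_univ_four]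
  field_simp
  ring

/-- Two strategies whose continuation part is Tit-for-Tat, with arbitrary
first-round cooperation probabilities `q0, p0 ∈ [0,1]`: as `w → 0+` the
expected per-round payoff tends to the mixture of the payoffs of the three
absorbing cycles, weighted by the probabilities of entering them. -/
theorem stmt16 (q0 p0 : ℝ) (hq0 : q0 ∈ Set.Icc (0 : ℝ) 1) (hp0 : p0 ∈ Set.Icc (0 : ℝ) 1)
    (aLL aLR aRL aRR : ℝ) :
    Filter.Tendsto
      (fun w => payoff w ![aLL, aLR, aRL, aRR] ![q0, 1, 0, 1, 0] ![p0, 1, 0, 1, 0])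
      (nhdsWithin 0 (Set.Ioi 0))
      (nhds (q0 * p0 * aLL + (1 - q0) * (1 - p0) * aRR +
        (q0 * (1 - p0) + (1 - q0) * p0) * (aLR + aRL) / 2)) := by
  have key : Filter.Tendsto (fun w : ℝ => q0 * p0 * aLL + (1 - q0) * (1 - p0) * aRR +
      (q0 * (1 - p0) * (aLR + (1 - w) * aRL) + (1 - q0) * p0 * ((1 - w) * aLR + aRL))
        / (2 - w)) (nhds 0) (nhds (q0 * p0 * aLL + (1 - q0) * (1 - p0) * aRR +
        (q0 * (1 - p0) + (1 - q0) * p0) * (aLR + aRL) / 2)) := by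
    have hc : ContinuousAt (fun w : ℝ => q0 * p0 * aLL + (1 - q0) * (1 - p0) * aRR +
      (q0 * (1 - p0) * (aLR + (1 - w) * aRL) + (1 - q0) * p0 * ((1 - w) * aLR + aRL))
        / (2 - w)) 0 := by
      refine ContinuousAt.add (by fun_prop) (ContinuousAt.div (by fun_prop) (by fun_prop) ?_)
      norm_num
    have h := hc.tendsto
    convert h using 2
    ring
  refine (key.mono_left nhdsWithin_le_nhds).congr' ?_
  filter_upwards [Ioo_mem_nhdsGT (show (0 : ℝ) < 1 by norm_num)] with w hw
  exact (tft_payoff q0 p0 aLL aLR aRL aRR w hw.1.ne' (by linarith [hw.2])).symm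
end
end
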